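/- High-dimensional rate bound for CAVI in Bayesian logistic regression under the generalized g-prior (Corollary 3, part (ii), finite-sample statement). Let X be a real n×p matrix with p ≥ 1, let g > 0, c > 0, and let c₁,…,c_n > 0. Define φ(t) := tanh(t/2)/(2t) for t ≠ 0, set Q₀ := (1/g)•XᵀX + c•1, Q := Xᵀ diag(φ(c₁),…,φ(c_n)) X + Q₀, and let A := Q^{-1/2} Xᵀ diag(φ'(c₁)²c₁²/φ(c₁), …, φ'(c_n)²c_n²/φ(c_n)) X Q^{-1/2}. Then λ_max(A) ≤ λ_max(XᵀX) / ((1 + 4/g)·λ_max(XᵀX) + 4c), and in particular λ_max(A) < 1. -/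

import Mathlib

open Matrix

/-- `λ_max`: for a real symmetric matrix, the largest element of its (real) spectrum. -/
noncomputable def lamMax {p : ℕ} (A : Matrix (Fin p) (Fin p) ℝ) : ℝ :=
  sSup (spectrum ℝ A)

/-- The Pólya–Gamma mean function `φ(t) = tanh(t/2)/(2t)`. -/
noncomputable def pgMean (t : ℝ) : ℝ := Real.tanh (t / 2) / (2 * t)

/-- The hyperbolic tangent lies below the identity on the nonnegative reals, in the form
`sinh x ≤ x * cosh x`. -/
theorem Real.sinh_le_mul_cosh {x : ℝ} (hx : 0 ≤ x) : Real.sinh x ≤ x * Real.cosh x := by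
  have hder (y : ℝ) : HasDerivAt (fun y => y * Real.cosh y - Real.sinh y) (y * Real.sinh y) y := by
    refine (((hasDerivAt_id y).mul (Real.hasDerivAt_cosh y)).sub
      (Real.hasDerivAt_sinh y)).congr_deriv ?_
    simp
  have hmono : MonotoneOn (fun y => y * Real.cosh y - Real.sinh y) (Set.Ici 0) := by
    refine monotoneOn_of_deriv_nonneg (convex_Ici 0)
      (fun y _ => (hder y).continuousAt.continuousWithinAt)
      (fun y _ => (hder y).differentiableAt.differentiableWithinAt) fun y hy => ?_
    rw [interior_Ici, Set.mem_Ioi] at hy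
    rw [(hder y).deriv]
    exact mul_nonneg hy.le (Real.sinh_nonneg_iff.2 hy.le)
  have h := hmono Set.self_mem_Ici (Set.mem_Ici.2 hx) hx
  simp only [Real.cosh_zero, Real.sinh_zero, zero_mul, sub_zero] at h
  linarith

theorem pgMean_pos {t : ℝ} (ht : 0 < t) : 0 < pgMean t := by
  rw [pgMean, Real.tanh_eq_sinh_div_cosh]
  have := Real.sinh_pos_iff.2 (half_pos ht)
  have := Real.cosh_pos (t / 2)
  positivity

theorem pgMean_le_one_fourth {t : ℝ} (ht : 0 < t) : pgMean t ≤ 1 / 4 := by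
  have h := Real.sinh_le_mul_cosh (half_pos ht).le
  have := Real.cosh_pos (t / 2)
  rw [pgMean, Real.tanh_eq_sinh_div_cosh, div_div, div_le_iff₀ (by positivity)]
  linarith

theorem deriv_pgMean_mul_self {t : ℝ} (ht : 0 < t) :
    deriv pgMean t * t = 1 / (4 * Real.cosh (t / 2) ^ 2) - pgMean t := by
  have hcosh := (Real.cosh_pos (t / 2)).ne'
  have hhalf : HasDerivAt (fun t : ℝ => t / 2) (1 / 2) t := (hasDerivAt_id t).div_const 2
  have hden : HasDerivAt (fun t : ℝ => 2 * t) 2 t := by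
    simpa using (hasDerivAt_id t).const_mul 2
  have h := ((hhalf.sinh.div hhalf.cosh hcosh).div hden (by positivity)).deriv
  have hfun : pgMean = (fun t => Real.sinh (t / 2)) / (fun t => Real.cosh (t / 2)) /
      fun t => 2 * t := by
    funext t
    simp [pgMean, Real.tanh_eq_sinh_div_cosh]
  have hsq := Real.cosh_sq (t / 2)
  rw [← hfun] at h
  rw [h, pgMean, Real.tanh_eq_sinh_div_cosh]
  simp only [Pi.div_apply]
  field_simp
  linear_combination (4 * t) * hsq

theorem deriv_pgMean_sq_mul_sq_div_le {t : ℝ} (ht : 0 < t) :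
    deriv pgMean t ^ 2 * t ^ 2 / pgMean t ≤ pgMean t := by
  have hpos := pgMean_pos ht
  have hcosh := Real.cosh_pos (t / 2)
  have hle : 1 / (4 * Real.cosh (t / 2) ^ 2) ≤ pgMean t := by
    have h := Real.self_le_sinh_iff.2 ht.le
    rw [show t = 2 * (t / 2) by ring, Real.sinh_two_mul, ← show t = 2 * (t / 2) by ring] at h
    rw [pgMean, Real.tanh_eq_sinh_div_cosh, div_div,
      div_le_div_iff₀ (by positivity) (by positivity)]
    nlinarith
  have hnonneg : 0 ≤ 1 / (4 * Real.cosh (t / 2) ^ 2) := by positivity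
  rw [div_le_iff₀ hpos, ← mul_pow, deriv_pgMean_mul_self ht]
  nlinarith

/-- A scalar bounds the spectrum of a real symmetric matrix from above iff it does so in the
Loewner order. -/
theorem posSemidef_smul_one_sub_iff {p : ℕ} {A : Matrix (Fin p) (Fin p) ℝ} (hA : A.IsHermitian)
    (r : ℝ) : (r • (1 : Matrix (Fin p) (Fin p) ℝ) - A).PosSemidef ↔ ∀ x ∈ spectrum ℝ A, x ≤ r := by
  have hr : (r • (1 : Matrix (Fin p) (Fin p) ℝ) - A).IsHermitian := by
    refine IsHermitian.sub ?_ hA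
    simp [IsHermitian]
  rw [posSemidef_iff_isHermitian_and_spectrum_nonneg, ← Algebra.algebraMap_eq_smul_one,
    ← spectrum.singleton_sub_eq]
  rw [← Algebra.algebraMap_eq_smul_one] at hr
  refine ⟨fun h x hx => ?_, fun h => ⟨hr, ?_⟩⟩
  · exact sub_nonneg.1 (h.2 (Set.sub_mem_sub rfl hx))
  · rintro _ ⟨_, rfl, x, hx, rfl⟩
    exact sub_nonneg.2 (h x hx)

theorem posSemidef_lamMax_smul_one_sub {p : ℕ} {A : Matrix (Fin p) (Fin p) ℝ}
    (hA : A.IsHermitian) : (lamMax A • (1 : Matrix (Fin p) (Fin p) ℝ) - A).PosSemidef :=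
  (posSemidef_smul_one_sub_iff hA _).2 fun _ hx => le_csSup A.finite_real_spectrum.bddAbove hx

theorem lamMax_le {p : ℕ} {A : Matrix (Fin p) (Fin p) ℝ} {r : ℝ} (hA : A.IsHermitian) (hr : 0 ≤ r)
    (h : (r • (1 : Matrix (Fin p) (Fin p) ℝ) - A).PosSemidef) : lamMax A ≤ r :=
  Real.sSup_le ((posSemidef_smul_one_sub_iff hA r).1 h) hr

theorem lamMax_nonneg {p : ℕ} {A : Matrix (Fin p) (Fin p) ℝ} (hA : A.PosSemidef) : 0 ≤ lamMax A :=
  Real.sSup_nonneg fun _ hx => (posSemidef_iff_isHermitian_and_spectrum_nonneg.1 hA).2 hx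

/-- If `M` is dominated by `r • S²` in the Loewner order, then `λ_max (S⁻¹ M S⁻¹) ≤ r`. -/
theorem lamMax_inv_mul_mul_inv_le {p : ℕ} {S M : Matrix (Fin p) (Fin p) ℝ} {r : ℝ}
    (hS : S.PosDef) (hM : M.IsHermitian) (hr : 0 ≤ r) (h : (r • (S * S) - M).PosSemidef) :
    lamMax (S⁻¹ * M * S⁻¹) ≤ r := by
  have hinv : S⁻¹ᴴ = S⁻¹ := hS.1.inv
  have hunit : IsUnit S.det := hS.det_pos.ne'.isUnit
  refine lamMax_le ?_ hr ?_
  · simpa only [hinv] using isHermitian_conjTranspose_mul_mul S⁻¹ hM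
  · have := h.conjTranspose_mul_mul_same S⁻¹
    rwa [hinv, mul_sub, sub_mul, Matrix.mul_smul, Matrix.smul_mul, ← mul_assoc,
      nonsing_inv_mul _ hunit, one_mul, mul_nonsing_inv _ hunit] at this

theorem isHermitian_transpose_mul_diagonal_mul {n p : ℕ} (X : Matrix (Fin n) (Fin p) ℝ)
    (d : Fin n → ℝ) : (Xᵀ * diagonal d * X).IsHermitian :=
  isHermitian_conjTranspose_mul_mul X (isHermitian_diagonal d)

theorem posSemidef_transpose_mul_diagonal_mul {n p : ℕ} (X : Matrix (Fin n) (Fin p) ℝ)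
    {d : Fin n → ℝ} (hd : ∀ i, 0 ≤ d i) : (Xᵀ * diagonal d * X).PosSemidef :=
  (PosSemidef.diagonal hd).conjTranspose_mul_mul_same X

/-- Loewner comparison behind the rate bound: weights `ψ ≤ φ` with `ψ ≤ 1 / 4` give
`D⁻¹ L • Q - Xᵀ diag(ψ) X ≥ 0`, where `L = λ_max(XᵀX)` and `D = (1 + 4 / g) * L + 4 * c`. -/
theorem posSemidef_smul_sub_of_weights_le {n p : ℕ} (X : Matrix (Fin n) (Fin p) ℝ) {g c : ℝ}
    (hg : 0 < g) (hc : 0 < c) {φ ψ : Fin n → ℝ} (hψφ : ∀ i, ψ i ≤ φ i) (hψ : ∀ i, ψ i ≤ 1 / 4) :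
    ((lamMax (Xᵀ * X) / ((1 + 4 / g) * lamMax (Xᵀ * X) + 4 * c)) •
      (Xᵀ * diagonal φ * X + ((1 / g) • (Xᵀ * X) + c • (1 : Matrix (Fin p) (Fin p) ℝ)))
      - Xᵀ * diagonal ψ * X).PosSemidef := by
  have hG : (Xᵀ * X).PosSemidef := posSemidef_conjTranspose_mul_self X
  have hL := lamMax_nonneg hG
  have hgap := posSemidef_lamMax_smul_one_sub hG.1
  set L := lamMax (Xᵀ * X)
  set D := (1 + 4 / g) * L + 4 * c with hD
  have hDpos : 0 < D := by positivity
  have hd (i : Fin n) : 0 ≤ L * (φ i - ψ i) + (L / g + c) * (1 - 4 * ψ i) := by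
    have h1 := sub_nonneg.2 (hψφ i)
    have h2 : 0 ≤ 1 - 4 * ψ i := by linarith [hψ i]
    positivity
  have hdiag : (diagonal fun i => L * (φ i - ψ i) + (L / g + c) * (1 - 4 * ψ i)) =
      L • diagonal φ - D • diagonal ψ + (L / g + c) • (1 : Matrix (Fin n) (Fin n) ℝ) := by
    ext i j
    by_cases hij : i = j
    · subst hij
      simp [hD]
      ring
    · simp [hij]
  have hsum := ((posSemidef_transpose_mul_diagonal_mul X hd).add (hgap.smul hc.le)).smul
    (inv_nonneg.2 hDpos.le)
  refine (congrArg PosSemidef ?_).mpr hsum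
  rw [hdiag]
  simp only [Matrix.mul_add, Matrix.add_mul, Matrix.mul_sub, Matrix.sub_mul, Matrix.mul_smul,
    Matrix.smul_mul, Matrix.mul_one]
  match_scalars <;> field_simp <;> ring

/-- High-dimensional rate bound for CAVI in Bayesian logistic regression under the
generalized g-prior `Q₀ = (1/g) • XᵀX + c • 1` (Corollary 3, part (ii), finite-sample
statement).  Here `S` is the unique symmetric positive definite square root of `Q`,
so that `S⁻¹ = Q^{-1/2}`. -/
theorem logit_g_prior_rate {n p : ℕ} (hp : 1 ≤ p)
    (X : Matrix (Fin n) (Fin p) ℝ) (g c : ℝ) (hg : 0 < g) (hc : 0 < c)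
    (cs : Fin n → ℝ) (hcs : ∀ i, 0 < cs i)
    (S : Matrix (Fin p) (Fin p) ℝ) (hS : S.PosDef)
    (hSsq : S * S = Xᵀ * Matrix.diagonal (fun i => pgMean (cs i)) * X
      + ((1 / g) • (Xᵀ * X) + c • (1 : Matrix (Fin p) (Fin p) ℝ))) :
    lamMax (S⁻¹ * (Xᵀ * Matrix.diagonal
        (fun i => (deriv pgMean (cs i)) ^ 2 * (cs i) ^ 2 / pgMean (cs i)) * X) * S⁻¹)
      ≤ lamMax (Xᵀ * X) / ((1 + 4 / g) * lamMax (Xᵀ * X) + 4 * c) ∧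
    lamMax (S⁻¹ * (Xᵀ * Matrix.diagonal
        (fun i => (deriv pgMean (cs i)) ^ 2 * (cs i) ^ 2 / pgMean (cs i)) * X) * S⁻¹) < 1 := by
  have hψφ (i : Fin n) := deriv_pgMean_sq_mul_sq_div_le (hcs i)
  have hpsd := posSemidef_smul_sub_of_weights_le X hg hc hψφ
    fun i => (hψφ i).trans (pgMean_le_one_fourth (hcs i))
  have hL : 0 ≤ lamMax (Xᵀ * X) := lamMax_nonneg (posSemidef_conjTranspose_mul_self X)
  rw [← hSsq] at hpsd
  have hle := lamMax_inv_mul_mul_inv_le hS (isHermitian_transpose_mul_diagonal_mul X _)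
    (by positivity) hpsd
  refine ⟨hle, hle.trans_lt ?_⟩
  rw [div_lt_one (by positivity)]
  have : 0 ≤ 4 / g * lamMax (Xᵀ * X) := by positivity
  linarith
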